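/- Consider the Gaussian linear model y = G a + ν with G ∈ ℝ^{M×E} satisfying ε I ⪯ GᵀG/M ⪯ (2−ε) I for some ε ∈ (0,1], a ~ N(0, Λ) with Λ = diag(λ_1,…,λ_E) positive definite and λ_e ≤ λ_1, and ν ~ N(0, σ² I) independent of a. Let H_B = (I + (σ²/M)Λ⁻¹)⁻¹ (Gᵀ/M) and â_B = H_B y. Then the trace of the error covariance satisfies tr Cov(a − â_B) ≤ σ² Σ_{e=1}^E λ_e/(ε M λ_e + σ²) + (ε + σ²/(λ_1 M))^{−4} (1−ε)² (2−ε)² (σ² E/M + Σ_{e=1}^E λ_e). -/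

import Mathlib

open MeasureTheory ProbabilityTheory Matrix

lemma aux_trace_mul_nonneg {n : ℕ} {K N : Matrix (Fin n) (Fin n) ℝ}
    (hK : K.PosSemidef) (hN : N.PosSemidef) : 0 ≤ (K * N).trace := by
  obtain ⟨B, rfl⟩ : ∃ B : Matrix (Fin n) (Fin n) ℝ, K = Bᴴ * B := by
    open scoped MatrixOrder in
    obtain ⟨B, hB⟩ := CStarAlgebra.nonneg_iff_eq_star_mul_self.mp hK.nonneg
    exact ⟨B, hB⟩
  have h := (hN.mul_mul_conjTranspose_same B).trace_nonneg
  rwa [Matrix.trace_mul_comm, ← Matrix.mul_assoc] at h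

lemma aux_sq {n : ℕ} {X : Matrix (Fin n) (Fin n) ℝ} {c : ℝ} (hc : 0 ≤ c)
    (h1 : (c • (1 : Matrix (Fin n) (Fin n) ℝ) - X).PosSemidef)
    (h2 : (c • (1 : Matrix (Fin n) (Fin n) ℝ) + X).PosSemidef) :
    ((c ^ 2) • (1 : Matrix (Fin n) (Fin n) ℝ) - X * X).PosSemidef := by
  rcases hc.eq_or_lt with rfl | hc
  · have hX : X.PosSemidef := by simpa using h2
    have hX' : (-X).PosSemidef := by simpa using h1
    have h0 : X.trace = 0 := by
      have h3 := hX.trace_nonneg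
      have h4 := hX'.trace_nonneg
      rw [Matrix.trace_neg] at h4
      linarith
    have : X = 0 := hX.trace_eq_zero_iff.mp h0
    subst this
    simpa using PosSemidef.zero
  · have h3 := h2.mul_mul_conjTranspose_same (c • (1 : Matrix (Fin n) (Fin n) ℝ) - X)
    have h4 := h1.mul_mul_conjTranspose_same (c • (1 : Matrix (Fin n) (Fin n) ℝ) + X)
    rw [h1.isHermitian.eq] at h3
    rw [h2.isHermitian.eq] at h4
    have h5 := (h3.add h4).smul (a := (1 / (2 * c))) (by positivity)
    convert h5 using 1
    simp only [mul_add, add_mul, mul_sub, sub_mul, Matrix.smul_mul, Matrix.mul_smul,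
      Matrix.mul_one, Matrix.one_mul, smul_add, smul_sub, smul_smul, Matrix.mul_assoc]
    match_scalars <;> field_simp <;> ring

lemma aux_sandwich {n : ℕ} {X K : Matrix (Fin n) (Fin n) ℝ} {c : ℝ} (hc : 0 ≤ c)
    (h1 : (c • (1 : Matrix (Fin n) (Fin n) ℝ) - X).PosSemidef)
    (h2 : (c • (1 : Matrix (Fin n) (Fin n) ℝ) + X).PosSemidef) (hK : K.PosSemidef) :
    (X * K * X).trace ≤ c ^ 2 * K.trace := by
  have h := aux_trace_mul_nonneg hK (aux_sq hc h1 h2)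
  rw [mul_sub, Matrix.mul_smul, Matrix.mul_one, Matrix.trace_sub, Matrix.trace_smul,
    smul_eq_mul, ← Matrix.mul_assoc, Matrix.trace_mul_comm (K * X), ← Matrix.mul_assoc] at h
  linarith

lemma aux_sandwich_psd {n : ℕ} {X K : Matrix (Fin n) (Fin n) ℝ}
    (hX : X.IsHermitian) (hK : K.PosSemidef) : (X * K * X).PosSemidef := by
  have h := hK.mul_mul_conjTranspose_same X
  rwa [hX.eq] at h

lemma aux_inv_antitone {n : ℕ} {S B : Matrix (Fin n) (Fin n) ℝ} (hB : B.PosDef)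
    (h : (S - B).PosSemidef) : S.PosDef ∧ (B⁻¹ - S⁻¹).PosSemidef := by
  have hS : S.PosDef := by
    have := hB.add_posSemidef h
    simpa using this
  refine ⟨hS, ?_⟩
  have hSd := (Matrix.isUnit_iff_isUnit_det S).mp hS.isUnit
  have hBd := (Matrix.isUnit_iff_isUnit_det B).mp hB.isUnit
  have e1 : S * S⁻¹ = 1 := Matrix.mul_nonsing_inv _ hSd
  have e2 : S⁻¹ * S = 1 := Matrix.nonsing_inv_mul _ hSd
  have e3 : B * B⁻¹ = 1 := Matrix.mul_nonsing_inv _ hBd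
  have e4 : B⁻¹ * B = 1 := Matrix.nonsing_inv_mul _ hBd
  have h1 := h.add (aux_sandwich_psd h.isHermitian hB.inv.posSemidef)
  have h2 := aux_sandwich_psd hS.inv.isHermitian h1
  convert h2 using 1
  have h3 : S - B + (S - B) * B⁻¹ * (S - B) = S * B⁻¹ * S - S := by
    simp only [mul_sub, sub_mul, Matrix.mul_assoc, e4, Matrix.mul_one]
    rw [← Matrix.mul_assoc B B⁻¹, e3, Matrix.one_mul]
    abel
  rw [h3, mul_sub, sub_mul, e2, Matrix.one_mul, Matrix.mul_assoc, Matrix.mul_assoc, e1,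
    Matrix.mul_one, ← Matrix.mul_assoc, e2, Matrix.one_mul]

lemma aux_inv_bound {n : ℕ} {S : Matrix (Fin n) (Fin n) ℝ} {c : ℝ} (hc : 0 < c)
    (h : (S - c • (1 : Matrix (Fin n) (Fin n) ℝ)).PosSemidef) :
    S.PosDef ∧ (c⁻¹ • (1 : Matrix (Fin n) (Fin n) ℝ) - S⁻¹).PosSemidef ∧
      (c⁻¹ • (1 : Matrix (Fin n) (Fin n) ℝ) + S⁻¹).PosSemidef := by
  have h1 : (c • (1 : Matrix (Fin n) (Fin n) ℝ)).PosDef := PosDef.one.smul hc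
  obtain ⟨hS, h2⟩ := aux_inv_antitone h1 h
  have h3 : (c • (1 : Matrix (Fin n) (Fin n) ℝ))⁻¹ = c⁻¹ • 1 := by
    apply Matrix.inv_eq_right_inv
    simp [smul_smul, hc.ne']
  rw [h3] at h2
  exact ⟨hS, h2, (PosSemidef.one.smul (by positivity)).add hS.inv.posSemidef⟩

lemma aux_identity {n : ℕ} (s : ℝ) (A D L S T Si Ti : Matrix (Fin n) (Fin n) ℝ)
    (hS : S = A + D) (hT : T = 1 + D) (hLD : L * D = s • 1) (hDL : D * L = s • 1)
    (hSi1 : S * Si = 1) (hSi2 : Si * S = 1) (hTi1 : T * Ti = 1) (hTi2 : Ti * T = 1) :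
    (1 - Ti * A) * L * (1 - A * Ti) + s • (Ti * A * Ti)
      = s • Si + Si * ((1 - A) * (Ti * (A * L * A + s • A) * Ti) * (1 - A)) * Si := by
  have hA : A = S - D := by rw [hS]; abel
  have hR : 1 - A = T - S := by rw [hS, hT]; abel
  have k1 : A * L * A + s • A = S * L * S - s • S := by
    rw [hA]
    simp only [mul_sub, sub_mul, hLD, Matrix.mul_assoc, smul_sub, Matrix.mul_smul, Matrix.mul_one]
    rw [← Matrix.mul_assoc D L, hDL]
    simp only [Matrix.smul_mul, Matrix.one_mul]
    abel
  have k2 : Si * (T - S) * Ti = Si - Ti := by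
    rw [mul_sub, sub_mul, hSi2, Matrix.one_mul, Matrix.mul_assoc, hTi1, Matrix.mul_one]
  have k3 : Ti * (T - S) * Si = Si - Ti := by
    rw [mul_sub, sub_mul, hTi2, Matrix.one_mul, Matrix.mul_assoc, hSi1, Matrix.mul_one]
  have k4 : Si * ((1 - A) * (Ti * (A * L * A + s • A) * Ti) * (1 - A)) * Si
      = (Si - Ti) * (S * L * S - s • S) * (Si - Ti) := by
    rw [hR, k1]
    nth_rewrite 1 [← k2]
    rw [← k3]
    simp only [Matrix.mul_assoc]
  have k5 : (Si - Ti) * (S * L * S - s • S) * (Si - Ti)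
      = L - L * S * Ti - Ti * S * L + Ti * S * L * S * Ti - s • (Si - Ti - Ti + Ti * S * Ti) := by
    have e1 : ∀ X, Si * (S * X) = X := fun X => by rw [← Matrix.mul_assoc, hSi2, Matrix.one_mul]
    simp only [mul_sub, sub_mul, Matrix.mul_assoc, Matrix.smul_mul, Matrix.mul_smul, hSi1, e1,
      Matrix.mul_one]
    module
  have k6 : 1 - Ti * A = Ti * (1 + D - A) := by
    rw [mul_sub, ← hT, hTi2]
  have k7 : 1 - A * Ti = (1 + D - A) * Ti := by
    rw [sub_mul, ← hT, hTi1]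
  have k8 : 1 + D - A = T - S + D := by rw [hT, hS]; abel
  rw [k4, k5, k6, k7, k8, hA]
  have e2 : ∀ X, Ti * (T * X) = X := fun X => by rw [← Matrix.mul_assoc, hTi2, Matrix.one_mul]
  have e3 : ∀ X, L * (D * X) = s • X := fun X => by
    rw [← Matrix.mul_assoc, hLD, Matrix.smul_mul, Matrix.one_mul]
  have e4 : ∀ X, D * (L * X) = s • X := fun X => by
    rw [← Matrix.mul_assoc, hDL, Matrix.smul_mul, Matrix.one_mul]
  simp only [mul_sub, sub_mul, mul_add, add_mul, Matrix.mul_assoc, Matrix.smul_mul,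
    Matrix.mul_smul, hTi1, hTi2, hDL, hLD, e3, e4, Matrix.mul_one, Matrix.one_mul]
  module

lemma aux_matrix {n : ℕ} (s ε l1 : ℝ) (hs : 0 < s) (hε : 0 < ε) (hε1 : ε ≤ 1) (hl1 : 0 < l1)
    (A : Matrix (Fin n) (Fin n) ℝ) (lam : Fin n → ℝ) (hl : ∀ e, 0 < lam e)
    (hl' : ∀ e, lam e ≤ l1)
    (hlow : (A - ε • (1 : Matrix (Fin n) (Fin n) ℝ)).PosSemidef)
    (hhigh : ((2 - ε) • (1 : Matrix (Fin n) (Fin n) ℝ) - A).PosSemidef)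
    (T : Matrix (Fin n) (Fin n) ℝ) (hT : T = 1 + s • (Matrix.diagonal lam)⁻¹) :
    T⁻¹ᵀ = T⁻¹ ∧
    ((1 - T⁻¹ * A) * Matrix.diagonal lam * (1 - A * T⁻¹) + s • (T⁻¹ * A * T⁻¹)).trace
      ≤ s * ∑ e, (ε + s / lam e)⁻¹
        + ((ε + s / l1)⁻¹) ^ 4 * (1 - ε) ^ 2 * (2 - ε) ^ 2 * (s * n + ∑ e, lam e) := by
  have hdi : (Matrix.diagonal lam)⁻¹ = Matrix.diagonal (fun e => (lam e)⁻¹) := by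
    apply Matrix.inv_eq_right_inv
    rw [Matrix.diagonal_mul_diagonal, ← Matrix.diagonal_one]
    congr 1; funext e; exact mul_inv_cancel₀ (hl e).ne'
  rw [hdi] at hT
  set D : Matrix (Fin n) (Fin n) ℝ := s • Matrix.diagonal (fun e => (lam e)⁻¹) with hD
  have hD' : D = Matrix.diagonal (fun e => s / lam e) := by
    rw [hD, ← Matrix.diagonal_smul]; rfl
  set c0 := ε + s / l1 with hc0
  have hc0p : 0 < c0 := by positivity
  have hDl : (D - (s / l1) • (1 : Matrix (Fin n) (Fin n) ℝ)).PosSemidef := by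
    rw [hD', Matrix.smul_one_eq_diagonal, Matrix.diagonal_sub]
    refine PosSemidef.diagonal fun e => ?_
    simp only [Pi.zero_apply, sub_nonneg]
    exact div_le_div_of_nonneg_left hs.le (hl e) (hl' e)
  have hTl : (T - c0 • (1 : Matrix (Fin n) (Fin n) ℝ)).PosSemidef := by
    have := hDl.add (PosSemidef.one.smul (a := 1 - ε) (by linarith))
    convert this using 1
    rw [hT, hc0]; module
  set S := A + D with hS
  have hSl : (S - c0 • (1 : Matrix (Fin n) (Fin n) ℝ)).PosSemidef := by
    convert hDl.add hlow using 1
    rw [hS, hc0]; module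
  obtain ⟨hTpd, hT1, hT2⟩ := aux_inv_bound hc0p hTl
  obtain ⟨hSpd, hS1, hS2⟩ := aux_inv_bound hc0p hSl
  have hTt : T⁻¹ᴴ = T⁻¹ := hTpd.inv.isHermitian.eq
  have hTt' : T⁻¹ᵀ = T⁻¹ := by
    rwa [Matrix.conjTranspose_eq_transpose_of_trivial] at hTt
  refine ⟨hTt', ?_⟩
  have hSd := (Matrix.isUnit_iff_isUnit_det S).mp hSpd.isUnit
  have hTd := (Matrix.isUnit_iff_isUnit_det T).mp hTpd.isUnit
  rw [aux_identity s A D (Matrix.diagonal lam) S T S⁻¹ T⁻¹ hS hT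
    (by rw [hD', Matrix.diagonal_mul_diagonal, Matrix.smul_one_eq_diagonal]
        congr 1; funext e; have := (hl e).ne'; field_simp)
    (by rw [hD', Matrix.diagonal_mul_diagonal, Matrix.smul_one_eq_diagonal]
        congr 1; funext e; have := (hl e).ne'; field_simp)
    (Matrix.mul_nonsing_inv _ hSd) (Matrix.nonsing_inv_mul _ hSd)
    (Matrix.mul_nonsing_inv _ hTd) (Matrix.nonsing_inv_mul _ hTd)]
  have hApsd : A.PosSemidef := by
    have := hlow.add (PosSemidef.one.smul (a := ε) hε.le)
    simpa using this
  have hLpsd : (Matrix.diagonal lam).PosSemidef := PosSemidef.diagonal fun e => (hl e).le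
  have hA2 : ((2 - ε) • (1 : Matrix (Fin n) (Fin n) ℝ) + A).PosSemidef :=
    (PosSemidef.one.smul (a := 2 - ε) (by linarith)).add hApsd
  have hR1 : ((1 - ε) • (1 : Matrix (Fin n) (Fin n) ℝ) - (1 - A)).PosSemidef := by
    convert hlow using 1; module
  have hR2 : ((1 - ε) • (1 : Matrix (Fin n) (Fin n) ℝ) + (1 - A)).PosSemidef := by
    convert hhigh using 1; module
  have hRh : (1 - A).IsHermitian := Matrix.isHermitian_one.sub hApsd.isHermitian
  have hK0 : (A * Matrix.diagonal lam * A + s • A).PosSemidef :=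
    (aux_sandwich_psd hApsd.isHermitian hLpsd).add (hApsd.smul hs.le)
  have hK1 := aux_sandwich_psd hTpd.inv.isHermitian hK0
  have hK2 := aux_sandwich_psd hRh hK1
  have b0 : (A * Matrix.diagonal lam * A + s • A).trace
      ≤ (2 - ε) ^ 2 * (s * n + ∑ e, lam e) := by
    rw [Matrix.trace_add, Matrix.trace_smul, smul_eq_mul]
    have h1 := aux_sandwich (by linarith) hhigh hA2 hLpsd
    rw [Matrix.trace_diagonal] at h1
    have h2 := hhigh.trace_nonneg
    rw [Matrix.trace_sub, Matrix.trace_smul, Matrix.trace_one, Fintype.card_fin,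
      smul_eq_mul] at h2
    have h3 : A.trace ≤ (2 - ε) ^ 2 * n := by
      have : (0 : ℝ) ≤ n := by positivity
      have : 0 ≤ (2 - ε) * (1 - ε) * n :=
        mul_nonneg (mul_nonneg (by linarith) (by linarith)) this
      nlinarith
    have h4 := mul_le_mul_of_nonneg_left h3 hs.le
    linarith
  have b1 := aux_sandwich (inv_pos.mpr hc0p).le hT1 hT2 hK0
  have b2 := aux_sandwich (by linarith) hR1 hR2 hK1
  have b3 := aux_sandwich (inv_pos.mpr hc0p).le hS1 hS2 hK2
  have bS : (S⁻¹).trace ≤ ∑ e, (ε + s / lam e)⁻¹ := by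
    have hB : (Matrix.diagonal fun e => ε + s / lam e).PosDef :=
      PosDef.diagonal fun e => by have := hl e; positivity
    have hBi : (Matrix.diagonal fun e => ε + s / lam e)⁻¹
        = Matrix.diagonal (fun e => (ε + s / lam e)⁻¹) := by
      apply Matrix.inv_eq_right_inv
      rw [Matrix.diagonal_mul_diagonal, ← Matrix.diagonal_one]
      congr 1; funext e
      have := hl e
      exact mul_inv_cancel₀ (by positivity)
    have h := (aux_inv_antitone (S := S) hB (by
      convert hlow using 1
      rw [hS, hD', Matrix.smul_one_eq_diagonal, ← Matrix.diagonal_add]; abel)).2.trace_nonneg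
    rw [hBi, Matrix.trace_sub, Matrix.trace_diagonal] at h
    linarith
  rw [Matrix.trace_add, Matrix.trace_smul, smul_eq_mul]
  refine add_le_add (mul_le_mul_of_nonneg_left bS hs.le) ?_
  refine b3.trans ?_
  refine (mul_le_mul_of_nonneg_left b2 (sq_nonneg _)).trans ?_
  refine (mul_le_mul_of_nonneg_left (mul_le_mul_of_nonneg_left b1 (sq_nonneg _))
    (sq_nonneg _)).trans ?_
  refine (mul_le_mul_of_nonneg_left (mul_le_mul_of_nonneg_left
    (mul_le_mul_of_nonneg_left b0 (sq_nonneg _)) (sq_nonneg _)) (sq_nonneg _)).trans ?_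
  apply le_of_eq; ring

lemma aux_sq_expand {Ω : Type*} [MeasurableSpace Ω] (P : Measure Ω) {n : ℕ}
    (X : Fin n → Ω → ℝ) (hX : ∀ i, MemLp (X i) 2 P) (d : Fin n → ℝ)
    (hcov : ∀ i j, ∫ ω, X i ω * X j ω ∂P = if i = j then d i else 0) (u : Fin n → ℝ) :
    ∫ ω, (∑ i, u i * X i ω) ^ 2 ∂P = ∑ i, u i ^ 2 * d i := by
  have hint : ∀ i j, Integrable (fun ω => X i ω * X j ω) P :=
    fun i j => (hX i).integrable_mul (hX j)
  have h1 : ∀ ω, (∑ i, u i * X i ω) ^ 2 = ∑ i, ∑ j, (u i * u j) * (X i ω * X j ω) := by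
    intro ω
    rw [sq, Finset.sum_mul_sum]
    refine Finset.sum_congr rfl fun i _ => Finset.sum_congr rfl fun j _ => by ring
  simp_rw [h1]
  rw [integral_finsetSum _ fun i _ => integrable_finsetSum _ fun j _ => (hint i j).const_mul _]
  refine Finset.sum_congr rfl fun i _ => ?_
  rw [integral_finsetSum _ fun j _ => (hint i j).const_mul _]
  simp_rw [integral_const_mul, hcov]
  simp [sq]

lemma aux_gauss {Ω : Type*} [MeasurableSpace Ω] (P : Measure Ω) {f : Ω → ℝ} (hf : Measurable f)
    {s : NNReal} (h : P.map f = gaussianReal 0 s) : MemLp f 2 P ∧ ∫ ω, f ω ∂P = 0 := by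
  constructor
  · have h1 : MemLp id 2 (P.map f) := by
      rw [h]; exact memLp_id_gaussianReal' 2 (by simp)
    exact h1.comp_of_map hf.aemeasurable
  · have h1 := integral_map (μ := P) hf.aemeasurable (f := fun x : ℝ => x)
      (by fun_prop)
    rw [← h1, h, integral_id_gaussianReal]

theorem trace_error_covariance_bound_fB
    {Ω : Type*} [MeasurableSpace Ω] (P : Measure Ω) [IsProbabilityMeasure P]
    (M E : ℕ) (hM : 0 < M) (hE : 0 < E)
    (G : Matrix (Fin M) (Fin E) ℝ)
    (ε : ℝ) (hε : ε ∈ Set.Ioc (0:ℝ) 1)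
    (hGlow : (((M : ℝ))⁻¹ • (Gᵀ * G) - ε • (1 : Matrix (Fin E) (Fin E) ℝ)).PosSemidef)
    (hGhigh : ((2 - ε) • (1 : Matrix (Fin E) (Fin E) ℝ)
        - ((M : ℝ))⁻¹ • (Gᵀ * G)).PosSemidef)
    (lam : Fin E → ℝ) (hlampos : ∀ e, 0 < lam e)
    (hlam1 : ∀ e, lam e ≤ lam ⟨0, hE⟩)
    (σ : ℝ) (hσ : 0 < σ)
    (a : Ω → Fin E → ℝ) (ν : Ω → Fin M → ℝ)
    (ha : Measurable a) (hν : Measurable ν)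
    (hindep : IndepFun a ν P)
    (hgauss : ∀ (u : Fin E → ℝ) (v : Fin M → ℝ), ∃ s : NNReal,
      P.map (fun ω => (∑ i, u i * a ω i) + ∑ m, v m * ν ω m) = gaussianReal 0 s)
    (hcova : ∀ i j, ∫ ω, a ω i * a ω j ∂P = Matrix.diagonal lam i j)
    (hcovν : ∀ m m', ∫ ω, ν ω m * ν ω m' ∂P = if m = m' then σ ^ 2 else 0)
    (y : Ω → Fin M → ℝ) (hy : ∀ ω, y ω = G.mulVec (a ω) + ν ω)
    (HB : Matrix (Fin E) (Fin M) ℝ)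
    (hHB : HB = ((1 : Matrix (Fin E) (Fin E) ℝ)
        + (σ ^ 2 / (M : ℝ)) • (Matrix.diagonal lam)⁻¹)⁻¹ * (((M : ℝ))⁻¹ • Gᵀ))
    (ahatB : Ω → Fin E → ℝ) (hahatB : ∀ ω, ahatB ω = HB.mulVec (y ω)) :
    ∑ i, ∫ ω, (a ω i - ahatB ω i) ^ 2 ∂P
      ≤ σ ^ 2 * ∑ e, lam e / (ε * M * lam e + σ ^ 2)
        + (1 / (ε + σ ^ 2 / (lam ⟨0, hE⟩ * M)) ^ 4) * (1 - ε) ^ 2 * (2 - ε) ^ 2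
          * (σ ^ 2 * E / M + ∑ e, lam e) := by
  have hM' : (0 : ℝ) < M := by exact_mod_cast hM
  have hgA : ∀ i, MemLp (fun ω => a ω i) 2 P ∧ ∫ ω, a ω i ∂P = 0 := by
    intro i
    obtain ⟨s, hs⟩ := hgauss (Pi.single i 1) 0
    refine aux_gauss P (by fun_prop) (s := s) ?_
    simpa [Pi.single_apply] using hs
  have hgN : ∀ m, MemLp (fun ω => ν ω m) 2 P ∧ ∫ ω, ν ω m ∂P = 0 := by
    intro m
    obtain ⟨s, hs⟩ := hgauss 0 (Pi.single m 1)
    refine aux_gauss P (by fun_prop) (s := s) ?_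
    simpa [Pi.single_apply] using hs
  have key : ∀ (u : Fin E → ℝ) (v : Fin M → ℝ),
      ∫ ω, ((∑ j, u j * a ω j) + ∑ m, v m * ν ω m) ^ 2 ∂P
        = ∑ j, u j ^ 2 * lam j + ∑ m, v m ^ 2 * σ ^ 2 := by
    intro u v
    have hU : MemLp (fun ω => ∑ j, u j * a ω j) 2 P :=
      memLp_finsetSum _ fun j _ => (hgA j).1.const_mul _
    have hV : MemLp (fun ω => ∑ m, v m * ν ω m) 2 P :=
      memLp_finsetSum _ fun j _ => (hgN j).1.const_mul _
    have hcross : ∫ ω, (∑ j, u j * a ω j) * (∑ m, v m * ν ω m) ∂P = 0 := by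
      have hi : IndepFun (fun ω => ∑ j, u j * a ω j) (fun ω => ∑ m, v m * ν ω m) P :=
        hindep.comp (φ := fun x : Fin E → ℝ => ∑ j, u j * x j)
          (ψ := fun x : Fin M → ℝ => ∑ j, v j * x j) (by fun_prop) (by fun_prop)
      rw [hi.integral_fun_mul_eq_mul_integral hU.1 hV.1]
      rw [integral_finsetSum _ fun j _ => ((hgA j).1.integrable (by norm_num)).const_mul _]
      simp_rw [integral_const_mul, (hgA _).2]
      simp
    have e : ∀ ω, ((∑ j, u j * a ω j) + ∑ m, v m * ν ω m) ^ 2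
        = (∑ j, u j * a ω j) ^ 2 + (2 * ((∑ j, u j * a ω j) * (∑ m, v m * ν ω m))
          + (∑ m, v m * ν ω m) ^ 2) := fun ω => by ring
    simp_rw [e]
    have i3 := (hU.integrable_mul hV).const_mul 2
    rw [integral_add hU.integrable_sq (by exact i3.add hV.integrable_sq),
      integral_add (by exact i3) hV.integrable_sq, integral_const_mul, hcross]
    rw [aux_sq_expand P (fun j ω => a ω j) (fun j => (hgA j).1) lam
      (fun i j => by rw [hcova, Matrix.diagonal_apply]) u]
    rw [aux_sq_expand P (fun j ω => ν ω j) (fun j => (hgN j).1) (fun _ => σ ^ 2)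
      (fun i j => hcovν i j) v]
    ring
  have herr : ∀ i, ∫ ω, (a ω i - ahatB ω i) ^ 2 ∂P
      = ∑ j, ((1 - HB * G : Matrix (Fin E) (Fin E) ℝ) i j) ^ 2 * lam j + ∑ m, (-HB i m) ^ 2 * σ ^ 2 := by
    intro i
    rw [← key]
    congr 1
    funext ω
    congr 1
    have e1 : ∑ j, (1 - HB * G : Matrix (Fin E) (Fin E) ℝ) i j * a ω j = ((1 - HB * G).mulVec (a ω)) i := rfl
    have e2 : ∑ m, -HB i m * ν ω m = - (HB.mulVec (ν ω)) i := by
      simp [Matrix.mulVec, dotProduct]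
    rw [e1, e2, hahatB, hy, Matrix.sub_mulVec, Matrix.one_mulVec, Matrix.mulVec_add,
      Matrix.mulVec_mulVec]
    simp only [Pi.sub_apply, Pi.add_apply]
    ring
  have htr : ∑ i, ∫ ω, (a ω i - ahatB ω i) ^ 2 ∂P
      = ((1 - HB * G) * Matrix.diagonal lam * (1 - HB * G)ᵀ + σ ^ 2 • (HB * HBᵀ)).trace := by
    rw [Matrix.trace]
    refine Finset.sum_congr rfl fun i _ => ?_
    rw [herr, Matrix.diag_apply, Matrix.add_apply, Matrix.smul_apply, Matrix.mul_apply,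
      Matrix.mul_apply, smul_eq_mul, Finset.mul_sum]
    congr 1
    · refine Finset.sum_congr rfl fun j _ => ?_
      rw [Matrix.mul_diagonal, Matrix.transpose_apply]; ring
    · refine Finset.sum_congr rfl fun j _ => ?_
      rw [Matrix.transpose_apply]; ring
  set T : Matrix (Fin E) (Fin E) ℝ := 1 + (σ ^ 2 / (M : ℝ)) • (Matrix.diagonal lam)⁻¹ with hT
  set A : Matrix (Fin E) (Fin E) ℝ := ((M : ℝ))⁻¹ • (Gᵀ * G) with hA
  obtain ⟨hTt, hmain⟩ := aux_matrix (σ ^ 2 / M) ε (lam ⟨0, hE⟩) (by positivity) hε.1 hε.2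
    (hlampos _) A lam hlampos hlam1 hGlow hGhigh T hT
  have hAt : Aᵀ = A := by
    rw [hA, Matrix.transpose_smul, Matrix.transpose_mul, Matrix.transpose_transpose]
  have hHG : HB * G = T⁻¹ * A := by
    rw [hHB, hA, Matrix.mul_assoc, Matrix.smul_mul]
  have hHH : σ ^ 2 • (HB * HBᵀ) = (σ ^ 2 / M) • (T⁻¹ * A * T⁻¹) := by
    rw [hHB, hA, Matrix.transpose_mul, hTt, Matrix.transpose_smul, Matrix.transpose_transpose]
    simp only [Matrix.smul_mul, Matrix.mul_smul, Matrix.mul_assoc, smul_smul]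
    congr 1
    ring
  have hHGt : (1 - HB * G)ᵀ = 1 - A * T⁻¹ := by
    rw [hHG, Matrix.transpose_sub, Matrix.transpose_one, Matrix.transpose_mul, hTt, hAt]
  rw [htr, hHGt, hHG, hHH]
  refine hmain.trans (le_of_eq ?_)
  congr 1
  · rw [Finset.mul_sum, Finset.mul_sum]
    refine Finset.sum_congr rfl fun e _ => ?_
    have h1 := hlampos e
    have h2 := hε.1
    have h3 : ε + σ ^ 2 / M / lam e = (ε * M * lam e + σ ^ 2) / (M * lam e) := by
      field_simp
    rw [h3, inv_div]
    field_simp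
  · rw [div_div, mul_comm (M : ℝ) (lam ⟨0, hE⟩), inv_pow, one_div]
    ring
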